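/- Let n ≥ 1 and let r ≥ 1 divide n. For every probability distribution δ on the set of permutations of {1,…,n}, there exists a permutation ρ of {1,…,n} such that for every subset S ⊆ {1,…,n} with |S| = r, ρ(S) ≤ 2r · E_{π∼δ}[π(S)]. -/

import Mathlib

open Finset

/-- The (1-indexed) access cost of a nonempty set `S` under a permutation `π` of `Fin n`:
the minimum, over elements `e ∈ S`, of the position `(π e) + 1` of `e`. -/
noncomputable def acc {n : ℕ} (π : Equiv.Perm (Fin n)) (S : Finset (Fin n)) : ℕ :=
  sInf ((fun e => (π e : ℕ) + 1) '' (S : Set (Fin n)))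

theorem aux_sum (s : Finset ℕ) : (∀ x ∈ s, 1 ≤ x) → s.card * (s.card + 1) ≤ 2 * ∑ x ∈ s, x := by
  induction s using Finset.induction_on_max with
  | empty => simp
  | insert a s hlt ih =>
    intro h
    have ha : a ∉ s := fun h' => lt_irrefl _ (hlt a h')
    have h1 := ih (fun x hx => h x (mem_insert_of_mem hx))
    have h2 : (insert a s).card ≤ (Finset.Icc 1 a).card := by
      apply card_le_card
      intro x hx
      rw [Finset.mem_Icc]
      refine ⟨h x hx, ?_⟩
      rcases mem_insert.1 hx with rfl | hx
      · exact le_rfl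
      · exact (hlt x hx).le
    rw [card_insert_of_notMem ha, Nat.card_Icc] at h2
    rw [card_insert_of_notMem ha, sum_insert ha]
    have h3 : s.card + 1 ≤ a := by omega
    nlinarith

theorem acc_mem {n : ℕ} (π : Equiv.Perm (Fin n)) (S : Finset (Fin n)) (h : S.Nonempty) :
    ∃ e ∈ S, (π e : ℕ) + 1 = acc π S := by
  have := Nat.sInf_mem (s := (fun e => (π e : ℕ) + 1) '' (S : Set (Fin n)))
    (Set.Nonempty.image _ (by simpa using h))
  obtain ⟨e, he, h'⟩ := this
  exact ⟨e, by simpa using he, h'⟩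

theorem acc_le {n : ℕ} (π : Equiv.Perm (Fin n)) (S : Finset (Fin n)) (e : Fin n) (h : e ∈ S) :
    acc π S ≤ (π e : ℕ) + 1 :=
  Nat.sInf_le ⟨e, by simpa using h, rfl⟩

theorem aux_blocks {n : ℕ} (r : ℕ) (hr : 1 ≤ r) (f : Finset (Fin n) → ℝ) (U : Finset (Fin n)) :
    ∃ b : Fin n → ℕ, (∀ i, (U.filter (fun e => b e = i)).card ≤ r) ∧
      ∀ S ⊆ U, S.card = r → ∃ e ∈ S, ∀ i ≤ b e,
        (U.filter (fun e => b e = i)).card = r ∧ f (U.filter (fun e => b e = i)) ≤ f S := by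
  induction U using Finset.strongInduction with
  | H U ih =>
    by_cases hU : U.card < r
    · refine ⟨fun _ => 0, fun i => (card_filter_le _ _).trans hU.le, fun S hS hc => ?_⟩
      have := card_le_card hS
      omega
    · obtain ⟨T, hT, hmin⟩ := exists_min_image (U.powersetCard r) f
        (powersetCard_nonempty.2 (not_lt.1 hU))
      rw [mem_powersetCard] at hT
      obtain ⟨hTU, hTc⟩ := hT
      have hTne : T.Nonempty := card_pos.1 (by omega)
      obtain ⟨b, hb1, hb2⟩ := ih (U \ T) (sdiff_ssubset hTU hTne)
      have e0 : U.filter (fun e => (if e ∈ T then 0 else b e + 1) = 0) = T := by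
        ext e
        have := @hTU e
        by_cases h : e ∈ T <;> simp [h]
        exact this h
      have e1 : ∀ i, U.filter (fun e => (if e ∈ T then 0 else b e + 1) = i + 1)
          = (U \ T).filter (fun e => b e = i) := by
        intro i
        ext e
        by_cases h : e ∈ T <;> simp [h]
      refine ⟨fun e => if e ∈ T then 0 else b e + 1, ?_, ?_⟩
      · rintro (_ | i)
        · rw [e0]; exact hTc.le
        · rw [e1]; exact hb1 i
      · intro S hS hc
        have hST := hmin S (mem_powersetCard.2 ⟨hS, hc⟩)
        by_cases hd : ∃ e ∈ S, e ∈ T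
        · obtain ⟨e, heS, heT⟩ := hd
          refine ⟨e, heS, fun i hi => ?_⟩
          simp only [heT, if_true] at hi
          obtain rfl : i = 0 := by omega
          rw [e0]
          exact ⟨hTc, hST⟩
        · push Not at hd
          obtain ⟨e, heS, he⟩ := hb2 S (fun x hx => mem_sdiff.2 ⟨hS hx, hd x hx⟩) hc
          refine ⟨e, heS, fun i hi => ?_⟩
          simp only [hd e heS, if_false] at hi
          rcases i with _ | i
          · rw [e0]; exact ⟨hTc, hST⟩
          · rw [e1]; exact he i (by omega)

/-- Greedy rounding: for every probability distribution `δ` over permutations of `{1,…,n}`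
(with `r ∣ n`) there is a single permutation `ρ` whose access cost on every `r`-element set
`S` is at most `2r` times the expected access cost of `S` under `δ`. -/
theorem stmt10 (n r : ℕ) (hn : 1 ≤ n) (hr : 1 ≤ r) (hdvd : r ∣ n)
    (δ : Equiv.Perm (Fin n) → ℝ) (hδ0 : ∀ π, 0 ≤ δ π)
    (hδ1 : ∑ π : Equiv.Perm (Fin n), δ π = 1) :
    ∃ ρ : Equiv.Perm (Fin n), ∀ S : Finset (Fin n), S.card = r →
      (acc ρ S : ℝ) ≤ 2 * (r : ℝ) * ∑ π : Equiv.Perm (Fin n), δ π * (acc π S : ℝ) := by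
  obtain ⟨b, hb1, hb2⟩ := aux_blocks r hr
    (fun S => ∑ π : Equiv.Perm (Fin n), δ π * (acc π S : ℝ)) univ
  refine ⟨(Tuple.sort b)⁻¹, fun S hS => ?_⟩
  obtain ⟨e, heS, he⟩ := hb2 S (subset_univ _) hS
  set j := b e with hj
  set T : ℕ → Finset (Fin n) := fun i => univ.filter (fun e => b e = i) with hT
  set E := ∑ π : Equiv.Perm (Fin n), δ π * (acc π S : ℝ) with hE
  have hpos : acc (Tuple.sort b)⁻¹ S ≤ (j + 1) * r := by
    refine (acc_le _ S e heS).trans ?_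
    set p := (Tuple.sort b)⁻¹ e with hp
    have hpe : Tuple.sort b p = e := by simp [hp]
    have h1 : ((Finset.Iic p).image (Tuple.sort b)) ⊆ (range (j + 1)).biUnion T := by
      intro x hx
      obtain ⟨q, hq, rfl⟩ := mem_image.1 hx
      have := Tuple.monotone_sort b (Finset.mem_Iic.1 hq)
      simp only [Function.comp, hpe] at this
      simp only [mem_biUnion, mem_range, hT, mem_filter, mem_univ, true_and]
      exact ⟨_, by omega, rfl⟩
    have h2 := card_le_card h1
    rw [card_image_of_injective _ (Tuple.sort b).injective, Fin.card_Iic] at h2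
    refine h2.trans (card_biUnion_le.trans ?_)
    refine (sum_le_sum (fun i _ => hb1 i)).trans ?_
    simp
  have hsum : ∀ π : Equiv.Perm (Fin n),
      (j + 1) * (j + 2) ≤ 2 * ∑ i ∈ range (j + 1), acc π (T i) := by
    intro π
    have hm : ∀ i ∈ range (j + 1), ∃ x ∈ T i, (π x : ℕ) + 1 = acc π (T i) := fun i hi =>
      acc_mem π (T i) (card_pos.1 (by
        have := (he i (by have := mem_range.1 hi; omega)).1
        simp only [hT]; omega))
    have hinj : Set.InjOn (fun i => acc π (T i)) (range (j + 1) : Set ℕ) := by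
      intro i hi k hk hik
      obtain ⟨x, hx, hx'⟩ := hm i (by exact_mod_cast hi)
      obtain ⟨y, hy, hy'⟩ := hm k (by exact_mod_cast hk)
      simp only at hik
      have hxy : x = y := π.injective (Fin.ext (by omega))
      subst hxy
      simp only [hT, mem_filter, mem_univ, true_and] at hx hy
      omega
    have := aux_sum ((range (j + 1)).image (fun i => acc π (T i))) (by
      intro x hx
      obtain ⟨i, hi, rfl⟩ := mem_image.1 hx
      obtain ⟨y, _, hy'⟩ := hm i hi
      omega)
    rw [card_image_of_injOn hinj, sum_image hinj, card_range] at this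
    exact this
  have hE1 : ((j : ℝ) + 1) * (j + 2) ≤ 2 * ((j + 1) * E) := by
    calc ((j : ℝ) + 1) * (j + 2) = ∑ π : Equiv.Perm (Fin n), δ π * (((j : ℝ) + 1) * (j + 2)) := by
          rw [← sum_mul, hδ1, one_mul]
      _ ≤ ∑ π : Equiv.Perm (Fin n), δ π * (2 * ∑ i ∈ range (j + 1), (acc π (T i) : ℝ)) := by
          refine sum_le_sum fun π _ => mul_le_mul_of_nonneg_left ?_ (hδ0 π)
          exact_mod_cast hsum π
      _ = 2 * ∑ i ∈ range (j + 1), ∑ π : Equiv.Perm (Fin n), δ π * (acc π (T i) : ℝ) := by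
          rw [sum_comm, mul_sum]
          refine sum_congr rfl fun π _ => ?_
          rw [← mul_sum]; ring
      _ ≤ 2 * ∑ i ∈ range (j + 1), E := by
          refine mul_le_mul_of_nonneg_left (sum_le_sum fun i hi => ?_) (by norm_num)
          exact (he i (by have := mem_range.1 hi; omega)).2
      _ = _ := by simp
  have hE2 : (j : ℝ) + 2 ≤ 2 * E := by
    have : (0 : ℝ) < j + 1 := by positivity
    nlinarith
  have hpos' : (acc (Tuple.sort b)⁻¹ S : ℝ) ≤ (j + 1) * r := by exact_mod_cast hpos
  have hr' : (0 : ℝ) ≤ r := by positivity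
  nlinarith
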